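/- (Theorem 1.) Let μ be a probability measure on ℝ^d with smooth, compactly supported density q, and let x ∈ ℝ^d be a point with q(x) > 0. For σ > 0, let ν_{σ,x} be the posterior with mean m_σ(x) and covariance Σ_σ(x). Then for all sufficiently small σ > 0 the matrix Σ_σ(x) is positive definite, and the pushforward of ν_{σ,x} under the standardization map z ↦ Σ_σ(x)^{−1/2}(z − m_σ(x)) converges weakly to the standard Gaussian measure N(0, I_d) on ℝ^d as σ → 0⁺. -/

import Mathlib

open MeasureTheory Filter Real

/-- The isotropic Gaussian density `φ_σ(w) = (2πσ²)^{-d/2} exp(-‖w‖²/(2σ²))` on `ℝ^d`. -/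
noncomputable def gaussDensity (d : ℕ) (σ : ℝ) (w : EuclideanSpace ℝ (Fin d)) : ℝ :=
  (2 * π * σ ^ 2) ^ (-(d : ℝ) / 2) * Real.exp (-‖w‖ ^ 2 / (2 * σ ^ 2))

/-- The posterior law `ν_{σ,x}(A) = (∫_A φ_σ(x - z) dμ(z)) / p_σ(x)`. -/
noncomputable def posterior {d : ℕ} (μ : Measure (EuclideanSpace ℝ (Fin d))) (σ : ℝ)
    (x : EuclideanSpace ℝ (Fin d)) : Measure (EuclideanSpace ℝ (Fin d)) :=
  (ENNReal.ofReal (∫ z, gaussDensity d σ (x - z) ∂μ))⁻¹ •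
    μ.withDensity fun z => ENNReal.ofReal (gaussDensity d σ (x - z))

/-- The standard Gaussian measure `N(0, I_d)` on `ℝ^d`. -/
noncomputable def stdGaussian (d : ℕ) : Measure (EuclideanSpace ℝ (Fin d)) :=
  volume.withDensity fun z => ENNReal.ofReal (gaussDensity d 1 z)


open scoped MatrixOrder in
theorem exists_posDef_sqrt {d : ℕ} (T : Matrix (Fin d) (Fin d) ℝ) (hT : T.PosDef) :
    ∃ P : Matrix (Fin d) (Fin d) ℝ, P.PosDef ∧ P * P = T := by
  have h0 : 0 ≤ T := hT.posSemidef.nonneg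
  have h1 := CFC.sqrt_mul_sqrt_self T h0
  refine ⟨CFC.sqrt T, ?_, h1⟩
  have h2 : (CFC.sqrt T).PosSemidef := Matrix.nonneg_iff_posSemidef.1 (CFC.sqrt_nonneg T)
  rw [h2.posDef_iff_isUnit]
  have := hT.isUnit
  rw [← h1] at this
  exact isUnit_of_mul_isUnit_left this

theorem sqrt_col_le {d : ℕ} (P T : Matrix (Fin d) (Fin d) ℝ) (hP : P.PosDef) (hT : P * P = T)
    (i j : Fin d) : ((P - 1) i j) ^ 2 ≤ ∑ k, ((T - 1) k j) ^ 2 := by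
  set u : Fin d → ℝ := fun k => (P - 1) k j with hu
  set t : Fin d → ℝ := fun k => (T - 1) k j with ht
  have h1 : t = P.mulVec u + u := by
    have : T - 1 = P * (P - 1) + (P - 1) := by rw [← hT]; noncomm_ring
    funext k
    rw [ht]; simp only [this]
    rfl
  have h2 : 0 ≤ u ⬝ᵥ P.mulVec u := by
    simpa using hP.posSemidef.dotProduct_mulVec_nonneg u
  have h3 : u ⬝ᵥ u ≤ u ⬝ᵥ t := by rw [h1, dotProduct_add]; linarith
  simp only [dotProduct] at h3
  have h4 : ∑ k, u k * t k ≤ ∑ k, (u k * u k + t k ^ 2) / 2 :=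
    Finset.sum_le_sum fun k _ => by nlinarith [sq_nonneg (u k - t k)]
  rw [← Finset.sum_div, Finset.sum_add_distrib] at h4
  have h5 : u i ^ 2 ≤ ∑ k, u k * u k := by
    have := Finset.single_le_sum (f := fun k => u k * u k) (fun k _ => mul_self_nonneg _) (Finset.mem_univ i)
    simpa [sq] using this
  linarith

theorem posDef_of_near_one {d : ℕ} (T : Matrix (Fin d) (Fin d) ℝ) (hs : ∀ i j, T i j = T j i)
    (h : ∀ i j, |T i j - (1 : Matrix (Fin d) (Fin d) ℝ) i j| ≤ 1 / (d + 1 : ℝ)) : T.PosDef := by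
  refine Matrix.PosDef.of_dotProduct_mulVec_pos ?_ ?_
  · ext i j; simp [hs j i]
  · intro v hv
    have hpos : 0 < ∑ i, v i ^ 2 := by
      obtain ⟨i, hi⟩ := Function.ne_iff.1 hv
      exact Finset.sum_pos' (fun _ _ => sq_nonneg _) ⟨i, Finset.mem_univ _, by
        have : v i ≠ 0 := hi
        positivity⟩
    have e : star v ⬝ᵥ T.mulVec v = ∑ i, v i ^ 2 + ∑ i, ∑ j, v i * v j * (T i j - (1 : Matrix (Fin d) (Fin d) ℝ) i j) := by
      have : ∑ i, v i ^ 2 = ∑ i, ∑ j, v i * v j * (1 : Matrix (Fin d) (Fin d) ℝ) i j := by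
        simp [Matrix.one_apply, sq]
      rw [this, ← Finset.sum_add_distrib]
      simp only [dotProduct, Matrix.mulVec, Finset.mul_sum, ← Finset.sum_add_distrib]
      refine Finset.sum_congr rfl fun i _ => Finset.sum_congr rfl fun j _ => ?_
      simp; ring
    have b : ∑ i, ∑ j, -((v i ^ 2 + v j ^ 2) / 2 * (1 / (d + 1 : ℝ))) ≤ ∑ i, ∑ j, v i * v j * (T i j - (1 : Matrix (Fin d) (Fin d) ℝ) i j) := by
      refine Finset.sum_le_sum fun i _ => Finset.sum_le_sum fun j _ => ?_
      have h1 := neg_abs_le (v i * v j * (T i j - (1 : Matrix (Fin d) (Fin d) ℝ) i j))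
      rw [abs_mul] at h1
      have h2 : |v i * v j| ≤ (v i ^ 2 + v j ^ 2) / 2 := by
        rw [abs_le]; constructor <;> nlinarith [sq_nonneg (v i - v j), sq_nonneg (v i + v j)]
      have h3 := mul_le_mul h2 (h i j) (abs_nonneg _) (by positivity)
      linarith
    have c : ∑ i, ∑ j, -((v i ^ 2 + v j ^ 2) / 2 * (1 / (d + 1 : ℝ))) = - (d / (d + 1 : ℝ)) * ∑ i, v i ^ 2 := by
      simp only [Finset.sum_neg_distrib, ← Finset.sum_mul, ← Finset.sum_div, Finset.sum_add_distrib]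
      simp [← Finset.mul_sum]
      field_simp
    rw [e]
    have : (d / (d + 1 : ℝ)) < 1 := by rw [div_lt_one] <;> linarith [(Nat.cast_nonneg d : (0:ℝ) ≤ d)]
    nlinarith

theorem tendsto_matrix_inv_one {d : ℕ} {l : Filter ℝ} (P : ℝ → Matrix (Fin d) (Fin d) ℝ)
    (h : Tendsto P l (nhds 1)) : Tendsto (fun s => (P s)⁻¹) l (nhds 1) := by
  have hd : Tendsto (fun s => (P s).det) l (nhds 1) := by
    have := ((continuous_id.matrix_det).tendsto (1 : Matrix (Fin d) (Fin d) ℝ)).comp h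
    simpa [Function.comp_def] using this
  have ha : Tendsto (fun s => (P s).adjugate) l (nhds 1) := by
    have := ((continuous_id.matrix_adjugate).tendsto (1 : Matrix (Fin d) (Fin d) ℝ)).comp h
    simpa [Function.comp_def] using this
  have := (hd.inv₀ one_ne_zero).smul ha
  simpa [Matrix.inv_def] using this

theorem gd_nonneg {d : ℕ} (σ : ℝ) (w : EuclideanSpace ℝ (Fin d)) : 0 ≤ gaussDensity d σ w := by
  unfold gaussDensity; positivity

theorem gd_cont {d : ℕ} (σ : ℝ) : Continuous (gaussDensity d σ) := by
  unfold gaussDensity; fun_prop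

theorem gd_neg {d : ℕ} (σ : ℝ) (w : EuclideanSpace ℝ (Fin d)) :
    gaussDensity d σ (-w) = gaussDensity d σ w := by
  unfold gaussDensity; simp

theorem gd_scale {d : ℕ} {σ : ℝ} (hσ : 0 < σ) :
    ∃ c : ℝ, 0 < c ∧ ∀ w : EuclideanSpace ℝ (Fin d),
      gaussDensity d σ (σ • w) = c * gaussDensity d 1 w := by
  refine ⟨(2 * π * σ ^ 2) ^ (-(d : ℝ) / 2) / (2 * π * 1 ^ 2) ^ (-(d : ℝ) / 2), by positivity, ?_⟩
  intro w
  unfold gaussDensity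
  have h : (2 * π * 1 ^ 2) ^ (-(d : ℝ) / 2) ≠ 0 := by positivity
  rw [← mul_assoc, div_mul_cancel₀ _ h]
  congr 2
  rw [norm_smul, Real.norm_eq_abs, mul_pow, sq_abs]
  field_simp

theorem gd_integrable {d : ℕ} :
    Integrable (fun w : EuclideanSpace ℝ (Fin d) => (1 + ‖w‖ ^ 2) * gaussDensity d 1 w) := by
  have h0 : Integrable (fun w : EuclideanSpace ℝ (Fin d) => Real.exp (-(1 / 4) * ‖w‖ ^ 2)) := by
    have := (GaussianFourier.integrable_cexp_neg_mul_sq_norm_add (V := EuclideanSpace ℝ (Fin d))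
      (b := ((1 / 4 : ℝ) : ℂ)) (by norm_num) 0 0).norm
    refine this.congr (Eventually.of_forall fun w => ?_)
    simp only [Complex.norm_exp]
    congr 1
    rw [zero_mul, add_zero, ← Complex.ofReal_pow, ← Complex.ofReal_neg, ← Complex.ofReal_mul,
      Complex.ofReal_re]
  refine (h0.const_mul (4 * (2 * π * 1 ^ 2) ^ (-(d : ℝ) / 2))).mono'
    (by have := gd_cont (d := d) 1; fun_prop) (Eventually.of_forall fun w => ?_)
  rw [Real.norm_of_nonneg (mul_nonneg (by positivity) (gd_nonneg _ _))]
  unfold gaussDensity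
  have h1 : 1 + ‖w‖ ^ 2 ≤ 4 * Real.exp (‖w‖ ^ 2 / 4) := by
    have := Real.add_one_le_exp (‖w‖ ^ 2 / 4); linarith
  have h2 : Real.exp (‖w‖ ^ 2 / 4) * Real.exp (-‖w‖ ^ 2 / (2 * 1 ^ 2)) = Real.exp (-(1 / 4) * ‖w‖ ^ 2) := by
    rw [← Real.exp_add]; congr 1; ring
  rw [← h2]
  have : 0 ≤ (2 * π * 1 ^ 2) ^ (-(d : ℝ) / 2) * Real.exp (-‖w‖ ^ 2 / (2 * 1 ^ 2)) := by positivity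
  nlinarith [mul_le_mul_of_nonneg_right h1 this]

theorem gd_prod {d : ℕ} (w : EuclideanSpace ℝ (Fin d)) :
    gaussDensity d 1 w = ∏ k, ProbabilityTheory.gaussianPDFReal 0 1 (w k) := by
  unfold gaussDensity ProbabilityTheory.gaussianPDFReal
  rw [Finset.prod_mul_distrib, ← Real.exp_sum, EuclideanSpace.norm_sq_eq]
  congr 1
  · simp only [one_pow, mul_one, NNReal.coe_one, Finset.prod_const, Finset.card_univ,
      Fintype.card_fin]
    rw [Real.sqrt_eq_rpow, ← Real.rpow_neg (by positivity), ← Real.rpow_natCast,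
      ← Real.rpow_mul (by positivity)]
    congr 1; ring
  · simp [← Finset.sum_div]

theorem gd_moment {d : ℕ} (n : Fin d → ℕ) :
    ∫ w : EuclideanSpace ℝ (Fin d), gaussDensity d 1 w * ∏ k, (w k) ^ (n k) =
      ∏ k, ∫ t, t ^ (n k) ∂(ProbabilityTheory.gaussianReal 0 1) := by
  rw [← (PiLp.volume_preserving_toLp (Fin d)).integral_comp
    (MeasurableEquiv.toLp 2 _).measurableEmbedding]
  simp only [gd_prod, ← Finset.prod_mul_distrib]
  rw [integral_fintype_prod_volume_eq_prod
    (fun k t => ProbabilityTheory.gaussianPDFReal 0 1 t * t ^ n k)]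
  refine Finset.prod_congr rfl fun k _ => ?_
  rw [ProbabilityTheory.integral_gaussianReal_eq_integral_smul one_ne_zero]
  simp

theorem gd_int_one {d : ℕ} : ∫ w : EuclideanSpace ℝ (Fin d), gaussDensity d 1 w = 1 := by
  simpa using gd_moment (d := d) (fun _ => 0)

theorem gd_cov {d : ℕ} (i j : Fin d) :
    ∫ w : EuclideanSpace ℝ (Fin d), gaussDensity d 1 w * (w i * w j) =
      (1 : Matrix (Fin d) (Fin d) ℝ) i j := by
  have h2 : ∫ t, t ^ 2 ∂(ProbabilityTheory.gaussianReal 0 1) = 1 := by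
    have := ProbabilityTheory.variance_fun_id_gaussianReal (μ := 0) (v := 1)
    rw [ProbabilityTheory.variance_of_integral_eq_zero (by fun_prop)
      ProbabilityTheory.integral_id_gaussianReal] at this
    simpa using this
  have h := gd_moment (d := d) (fun k => (if k = i then 1 else 0) + (if k = j then 1 else 0))
  simp only [pow_add, Finset.prod_mul_distrib] at h
  simp only [pow_ite, pow_one, pow_zero, Finset.prod_ite_eq', Finset.mem_univ, if_true] at h
  rw [h]
  by_cases hij : i = j
  · subst hij
    rw [Matrix.one_apply_eq]
    refine Finset.prod_eq_one fun k _ => ?_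
    by_cases hk : k = i
    · simpa [hk, sq] using h2
    · simp [hk]
  · rw [Matrix.one_apply_ne hij]
    refine Finset.prod_eq_zero (Finset.mem_univ i) ?_
    simp [hij]

theorem gd_mean {d : ℕ} : ∫ w : EuclideanSpace ℝ (Fin d), gaussDensity d 1 w • w = 0 := by
  have h := integral_neg_eq_self (fun w : EuclideanSpace ℝ (Fin d) => gaussDensity d 1 w • w) volume
  simp only [gd_neg, smul_neg, integral_neg] at h
  have h2 : (2 : ℝ) • ∫ w : EuclideanSpace ℝ (Fin d), gaussDensity d 1 w • w = 0 := by
    rw [two_smul]; nth_rewrite 1 [← h]; simp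
  simpa using h2

theorem posterior_integral {d : ℕ} {F : Type} [NormedAddCommGroup F] [NormedSpace ℝ F]
    (μ : Measure (EuclideanSpace ℝ (Fin d)))
    (q : EuclideanSpace ℝ (Fin d) → ℝ) (hq : Continuous q) (hq0 : ∀ z, 0 ≤ q z)
    (hμ : μ = volume.withDensity fun z => ENNReal.ofReal (q z))
    (x : EuclideanSpace ℝ (Fin d)) {σ : ℝ} (hσ : 0 < σ) (g : EuclideanSpace ℝ (Fin d) → F) :
    ∫ z, g z ∂(posterior μ σ x) =
      (∫ w, gaussDensity d 1 w * q (x + σ • w))⁻¹ •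
        ∫ w, (gaussDensity d 1 w * q (x + σ • w)) • g (x + σ • w) := by
  obtain ⟨c, hc, hcw⟩ := gd_scale (d := d) hσ
  have key : ∀ {G : Type _} [NormedAddCommGroup G] [NormedSpace ℝ G]
      (g : EuclideanSpace ℝ (Fin d) → G),
      ∫ z, gaussDensity d σ (x - z) • g z ∂μ =
        (c * σ ^ d) • ∫ w, (gaussDensity d 1 w * q (x + σ • w)) • g (x + σ • w) := by
    intro G _ _ g
    rw [hμ, integral_withDensity_eq_integral_toReal_smul (by fun_prop)
      (Eventually.of_forall fun _ => ENNReal.ofReal_lt_top)]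
    rw [← integral_add_left_eq_self _ x]
    have h1 := Measure.integral_comp_smul (μ := (volume : Measure (EuclideanSpace ℝ (Fin d))))
      (fun z => (ENNReal.ofReal (q (x + z))).toReal • gaussDensity d σ (x - (x + z)) • g (x + z)) σ
    have hσd : 0 < σ ^ d := by positivity
    rw [finrank_euclideanSpace_fin, abs_of_pos (by positivity), eq_inv_smul_iff₀ hσd.ne'] at h1
    rw [← h1, mul_comm, mul_smul]
    congr 1
    rw [← integral_smul]
    refine integral_congr_ae (Eventually.of_forall fun w => ?_)
    simp only [sub_add_cancel_left, gd_neg, hcw, ENNReal.toReal_ofReal (hq0 _), smul_smul]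
    congr 1; ring
  have k1 := key (fun _ => (1 : ℝ))
  simp only [smul_eq_mul, mul_one] at k1
  have hk : c * σ ^ d ≠ 0 := by positivity
  unfold posterior
  rw [integral_smul_measure, integral_withDensity_eq_integral_toReal_smul
    (by have := gd_cont (d := d) σ; fun_prop) (Eventually.of_forall fun _ => ENNReal.ofReal_lt_top)]
  simp only [ENNReal.toReal_ofReal (gd_nonneg _ _)]
  rw [key g, ENNReal.toReal_inv, ENNReal.toReal_ofReal (integral_nonneg fun _ => gd_nonneg _ _), k1,
    smul_smul]
  congr 1
  field_simp

theorem tendsto_gd {d : ℕ} {F : Type} [NormedAddCommGroup F] [NormedSpace ℝ F]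
    (q : EuclideanSpace ℝ (Fin d) → ℝ) (hq : Continuous q) (hqc : HasCompactSupport q)
    (x : EuclideanSpace ℝ (Fin d)) (h : ℝ → EuclideanSpace ℝ (Fin d) → F)
    (h0 : EuclideanSpace ℝ (Fin d) → F) (C : ℝ)
    (hc : ∀ᶠ σ in nhdsWithin (0 : ℝ) (Set.Ioi 0), Continuous (h σ))
    (hb : ∀ᶠ σ in nhdsWithin (0 : ℝ) (Set.Ioi 0), ∀ w, ‖h σ w‖ ≤ C * (1 + ‖w‖ ^ 2))
    (hl : ∀ w, Tendsto (fun σ => h σ w) (nhdsWithin (0 : ℝ) (Set.Ioi 0)) (nhds (h0 w))) :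
    Tendsto (fun σ : ℝ => ∫ w, (gaussDensity d 1 w * q (x + σ • w)) • h σ w)
      (nhdsWithin (0 : ℝ) (Set.Ioi 0)) (nhds (q x • ∫ w, gaussDensity d 1 w • h0 w)) := by
  obtain ⟨B, hB⟩ := hq.bounded_above_of_compact_support hqc
  have hg := gd_cont (d := d) 1
  have e : q x • ∫ w, gaussDensity d 1 w • h0 w = ∫ w, (gaussDensity d 1 w * q x) • h0 w := by
    rw [← integral_smul]
    simp only [smul_smul, mul_comm]
  rw [e]
  refine tendsto_integral_filter_of_dominated_convergence
    (fun w => B * C * ((1 + ‖w‖ ^ 2) * gaussDensity d 1 w)) ?_ ?_ (gd_integrable.const_mul _) ?_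
  · filter_upwards [hc] with σ hσ
    exact (Continuous.smul (by fun_prop) hσ).aestronglyMeasurable
  · filter_upwards [hb] with σ hσ
    refine Eventually.of_forall fun w => ?_
    rw [norm_smul, norm_mul, Real.norm_of_nonneg (gd_nonneg _ _)]
    have h1 := mul_le_mul (hB (x + σ • w)) (hσ w) (norm_nonneg _) ((norm_nonneg _).trans (hB x))
    nlinarith [mul_le_mul_of_nonneg_left h1 (gd_nonneg 1 w)]
  · refine Eventually.of_forall fun w => ?_
    refine Tendsto.smul (Tendsto.const_mul _ ?_) (hl w)
    have : Continuous fun σ : ℝ => q (x + σ • w) := by fun_prop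
    simpa using (this.tendsto 0).mono_left nhdsWithin_le_nhds

/-- **Theorem 1 (moment-matching Gaussian approximation becomes exact).** Let `μ` be a
probability measure on `ℝ^d` with smooth compactly supported density `q`, and `x` a point
with `q(x) > 0`. Let `m_σ(x)` and `Σ_σ(x)` be the mean and covariance of the posterior
`ν_{σ,x}`. Then for all sufficiently small `σ > 0` the matrix `Σ_σ(x)` is positive definite
(with positive definite square root `R σ`), and the pushforward of `ν_{σ,x}` under
`z ↦ Σ_σ(x)^{-1/2}(z - m_σ(x))` converges weakly to `N(0, I_d)` as `σ → 0⁺` (tested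
against all bounded continuous functions). -/
theorem standardized_posterior_tendsto_gaussian {d : ℕ}
    (μ : Measure (EuclideanSpace ℝ (Fin d))) [IsProbabilityMeasure μ]
    (q : EuclideanSpace ℝ (Fin d) → ℝ) (hq : ContDiff ℝ (⊤ : ℕ∞) q)
    (hqc : HasCompactSupport q) (hq0 : ∀ z, 0 ≤ q z)
    (hμ : μ = volume.withDensity fun z => ENNReal.ofReal (q z))
    (x : EuclideanSpace ℝ (Fin d)) (hx : 0 < q x)
    (m : ℝ → EuclideanSpace ℝ (Fin d))
    (hm : ∀ σ, m σ = ∫ z, z ∂(posterior μ σ x))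
    (S : ℝ → Matrix (Fin d) (Fin d) ℝ)
    (hS : ∀ σ, S σ = Matrix.of fun i j =>
        ∫ z, (z i - m σ i) * (z j - m σ j) ∂(posterior μ σ x)) :
    ∃ σ₀ > (0 : ℝ), (∀ σ ∈ Set.Ioo (0 : ℝ) σ₀, (S σ).PosDef) ∧
      ∃ R : ℝ → Matrix (Fin d) (Fin d) ℝ,
        (∀ σ ∈ Set.Ioo (0 : ℝ) σ₀, (R σ).PosDef ∧ R σ * R σ = S σ) ∧
        ∀ f : BoundedContinuousFunction (EuclideanSpace ℝ (Fin d)) ℝ,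
          Tendsto (fun σ : ℝ => ∫ z,
              f ((EuclideanSpace.equiv (Fin d) ℝ).symm
                ((R σ)⁻¹.mulVec fun i => z i - m σ i)) ∂(posterior μ σ x))
            (nhdsWithin 0 (Set.Ioi 0)) (nhds (∫ z, f z ∂(stdGaussian d))) := by
  classical
  have hqC : Continuous q := hq.continuous
  have hg := gd_cont (d := d) 1
  set l := nhdsWithin (0 : ℝ) (Set.Ioi 0) with hl
  have hpos : ∀ᶠ σ in l, 0 < σ := self_mem_nhdsWithin
  set D : ℝ → ℝ := fun σ => ∫ w, gaussDensity d 1 w * q (x + σ • w) with hD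
  have hpi : ∀ {F : Type} [NormedAddCommGroup F] [NormedSpace ℝ F] (σ : ℝ), 0 < σ →
      ∀ g : EuclideanSpace ℝ (Fin d) → F, ∫ z, g z ∂(posterior μ σ x) =
      (D σ)⁻¹ • ∫ w, (gaussDensity d 1 w * q (x + σ • w)) • g (x + σ • w) :=
    fun σ hσ g => posterior_integral μ q hqC hq0 hμ x hσ g
  have hDl : Tendsto D l (nhds (q x)) := by
    have := tendsto_gd q hqC hqc x (fun _ _ => (1 : ℝ)) (fun _ => 1) 1
      (Eventually.of_forall fun _ => continuous_const)
      (Eventually.of_forall fun _ w => by simp) (fun w => tendsto_const_nhds)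
    simpa [gd_int_one] using this
  have hlim : ∀ {F : Type} [NormedAddCommGroup F] [NormedSpace ℝ F]
      (h : ℝ → EuclideanSpace ℝ (Fin d) → F) (h0 : EuclideanSpace ℝ (Fin d) → F) (C : ℝ)
      (_ : ∀ᶠ σ in l, Continuous (h σ))
      (_ : ∀ᶠ σ in l, ∀ w, ‖h σ w‖ ≤ C * (1 + ‖w‖ ^ 2))
      (_ : ∀ w, Tendsto (fun σ => h σ w) l (nhds (h0 w))),
      Tendsto (fun σ : ℝ => (D σ)⁻¹ • ∫ w, (gaussDensity d 1 w * q (x + σ • w)) • h σ w)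
        l (nhds (∫ w, gaussDensity d 1 w • h0 w)) := by
    intro F _ _ h h0 C h1 h2 h3
    have := (hDl.inv₀ hx.ne').smul (tendsto_gd q hqC hqc x h h0 C h1 h2 h3)
    rwa [smul_smul, inv_mul_cancel₀ hx.ne', one_smul] at this
  have hDpos : ∀ᶠ σ in l, 0 < D σ := hDl.eventually (lt_mem_nhds hx)
  -- the rescaled mean
  set a : ℝ → EuclideanSpace ℝ (Fin d) := fun σ =>
    (D σ)⁻¹ • ∫ w, (gaussDensity d 1 w * q (x + σ • w)) • w with ha
  have hal : Tendsto a l (nhds 0) := by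
    have := hlim (fun _ w => w) (fun w => w) 1 (Eventually.of_forall fun _ => continuous_id)
      (Eventually.of_forall fun _ w => by nlinarith [sq_nonneg (‖w‖ - 1), norm_nonneg w])
      (fun w => tendsto_const_nhds)
    rwa [gd_mean] at this
  obtain ⟨B, hB⟩ := hqC.bounded_above_of_compact_support hqc
  have hint : ∀ σ : ℝ, ∀ {F : Type} [NormedAddCommGroup F] [NormedSpace ℝ F]
      (h : EuclideanSpace ℝ (Fin d) → F), Continuous h → (∀ w, ‖h w‖ ≤ 1 + ‖w‖ ^ 2) →
      Integrable (fun w => (gaussDensity d 1 w * q (x + σ • w)) • h w) := by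
    intro σ F _ _ h hc hb
    refine (gd_integrable.const_mul B).mono'
      (Continuous.smul (by fun_prop) hc).aestronglyMeasurable (Eventually.of_forall fun w => ?_)
    rw [norm_smul, norm_mul, Real.norm_of_nonneg (gd_nonneg _ _)]
    have h1 := mul_le_mul (hB (x + σ • w)) (hb w) (norm_nonneg _) ((norm_nonneg _).trans (hB x))
    nlinarith [mul_le_mul_of_nonneg_left h1 (gd_nonneg 1 w)]
  have hma : ∀ σ, 0 < σ → 0 < D σ → m σ = x + σ • a σ := by
    intro σ hσ hDσ
    rw [hm, hpi σ hσ]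
    have i1 := hint σ (fun _ => (1 : ℝ)) continuous_const (fun w => by simp)
    have i2 := hint σ (fun w => w) continuous_id
      (fun w => by nlinarith [sq_nonneg (‖w‖ - 1), norm_nonneg w])
    simp only [smul_eq_mul, mul_one] at i1
    have e : ∀ w : EuclideanSpace ℝ (Fin d), (gaussDensity d 1 w * q (x + σ • w)) • (x + σ • w) =
        (gaussDensity d 1 w * q (x + σ • w)) • x +
          σ • ((gaussDensity d 1 w * q (x + σ • w)) • w) := by
      intro w; rw [smul_add, smul_comm σ]
    simp only [e]
    have i3 : Integrable (fun w => σ • ((gaussDensity d 1 w * q (x + σ • w)) • w)) := i2.smul σ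
    rw [integral_add (i1.smul_const x) i3, integral_smul_const, integral_smul, smul_add,
      smul_smul, inv_mul_cancel₀ hDσ.ne', one_smul, smul_comm]
  -- the rescaled covariance
  set T : ℝ → Matrix (Fin d) (Fin d) ℝ := fun σ => Matrix.of fun i j =>
    (D σ)⁻¹ • ∫ w, (gaussDensity d 1 w * q (x + σ • w)) • ((w i - a σ i) * (w j - a σ j)) with hT
  have hTs : ∀ σ i j, T σ i j = T σ j i := by
    intro σ i j
    simp only [hT, Matrix.of_apply]
    simp only [mul_comm]
  have hcoord : ∀ i, Tendsto (fun σ => a σ i) l (nhds 0) := by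
    intro i
    have hc : Continuous fun v : EuclideanSpace ℝ (Fin d) => v i := by fun_prop
    simpa [Function.comp_def] using (hc.tendsto 0).comp hal
  have hTl : ∀ i j, Tendsto (fun σ => T σ i j) l
      (nhds ((1 : Matrix (Fin d) (Fin d) ℝ) i j)) := by
    intro i j
    have ha1 : ∀ᶠ σ in l, ‖a σ‖ < 1 := by
      have := hal.norm
      rw [norm_zero] at this
      exact this.eventually (gt_mem_nhds one_pos)
    have := hlim (fun σ w => (w i - a σ i) * (w j - a σ j)) (fun w => w i * w j) 2
      (Eventually.of_forall fun σ => by fun_prop) ?_ ?_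
    · simp only [smul_eq_mul, gd_cov] at this
      exact this
    · filter_upwards [ha1] with σ h1 w
      have hk : ∀ k, ‖w k - a σ k‖ ≤ ‖w‖ + 1 := by
        intro k
        have := PiLp.norm_apply_le (w - a σ) k
        have h2 := norm_sub_le w (a σ)
        simp only [PiLp.sub_apply] at this
        linarith
      rw [norm_mul]
      have := mul_le_mul (hk i) (hk j) (norm_nonneg _) (by positivity)
      nlinarith [sq_nonneg (‖w‖ - 1)]
    · intro w
      simpa using ((hcoord i).const_sub (w i)).mul ((hcoord j).const_sub (w j))
  have hTpd : ∀ᶠ σ in l, (T σ).PosDef := by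
    have : ∀ᶠ σ in l, ∀ i j,
        |T σ i j - (1 : Matrix (Fin d) (Fin d) ℝ) i j| ≤ 1 / (d + 1 : ℝ) := by
      rw [eventually_all]; intro i
      rw [eventually_all]; intro j
      have h := ((hTl i j).sub_const ((1 : Matrix (Fin d) (Fin d) ℝ) i j)).abs
      rw [sub_self, abs_zero] at h
      exact (h.eventually (gt_mem_nhds (show (0 : ℝ) < 1 / (d + 1 : ℝ) by positivity))).mono
        fun σ h => h.le
    exact this.mono fun σ h => posDef_of_near_one _ (hTs σ) h
  have hST : ∀ σ, 0 < σ → 0 < D σ → S σ = σ ^ 2 • T σ := by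
    intro σ hσ hDσ
    ext i j
    rw [hS, Matrix.of_apply, hpi σ hσ, Matrix.smul_apply]
    simp only [hT, Matrix.of_apply]
    rw [smul_comm (σ ^ 2), ← integral_smul (σ ^ 2)]
    congr 2; funext w
    simp only [hma σ hσ hDσ, PiLp.add_apply, PiLp.smul_apply, smul_eq_mul]
    ring
  have hex : ∀ σ, ∃ P : Matrix (Fin d) (Fin d) ℝ, (T σ).PosDef → P.PosDef ∧ P * P = T σ := by
    intro σ
    by_cases h : (T σ).PosDef
    · obtain ⟨P, hP⟩ := exists_posDef_sqrt _ h
      exact ⟨P, fun _ => hP⟩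
    · exact ⟨0, fun h' => absurd h' h⟩
  choose P hP using hex
  have hPl : Tendsto P l (nhds 1) := by
    refine tendsto_pi_nhds.2 fun i => tendsto_pi_nhds.2 fun j => ?_
    have h1 : Tendsto (fun σ => ∑ k, ((T σ - 1) k j) ^ 2) l (nhds 0) := by
      have : ∀ k ∈ Finset.univ, Tendsto (fun σ => ((T σ - 1) k j) ^ 2) l (nhds 0) := by
        intro k _
        simpa using ((hTl k j).sub_const ((1 : Matrix (Fin d) (Fin d) ℝ) k j)).pow 2
      simpa using tendsto_finsetSum _ this
    have h2 : Tendsto (fun σ => ((P σ - 1) i j) ^ 2) l (nhds 0) :=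
      tendsto_of_tendsto_of_tendsto_of_le_of_le' tendsto_const_nhds h1
        (Eventually.of_forall fun _ => sq_nonneg _)
        (hTpd.mono fun σ h => sqrt_col_le _ _ (hP σ h).1 (hP σ h).2 i j)
    have h3 : Tendsto (fun σ => |(P σ - 1) i j|) l (nhds 0) := by
      have := h2.sqrt
      simpa [Real.sqrt_sq_eq_abs] using this
    have h4 := ((tendsto_zero_iff_abs_tendsto_zero _).2 h3).add_const
      ((1 : Matrix (Fin d) (Fin d) ℝ) i j)
    simpa using h4
  have hPinv := tendsto_matrix_inv_one P hPl
  obtain ⟨σ₀, hσ₀, hsub⟩ := mem_nhdsGT_iff_exists_Ioo_subset.1 (hTpd.and hDpos)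
  refine ⟨σ₀, hσ₀, ?_, fun σ => σ • P σ, ?_, ?_⟩
  · intro σ hσ
    obtain ⟨h1, h2⟩ := hsub hσ
    rw [hST σ hσ.1 h2]
    exact h1.smul (pow_pos hσ.1 2)
  · intro σ hσ
    obtain ⟨h1, h2⟩ := hsub hσ
    refine ⟨(hP σ h1).1.smul hσ.1, ?_⟩
    rw [hST σ hσ.1 h2, ← (hP σ h1).2, smul_mul_smul_comm, sq]
  · intro f
    have e0 : ∫ z, f z ∂(stdGaussian d) = ∫ w, gaussDensity d 1 w • f w := by
      unfold stdGaussian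
      rw [integral_withDensity_eq_integral_toReal_smul (by fun_prop)
        (Eventually.of_forall fun _ => ENNReal.ofReal_lt_top)]
      simp only [ENNReal.toReal_ofReal (gd_nonneg _ _)]
    rw [e0]
    have key := hlim (fun σ w => f ((EuclideanSpace.equiv (Fin d) ℝ).symm
        ((P σ)⁻¹.mulVec fun i => w i - a σ i))) (fun w => f w) ‖f‖ ?_ ?_ ?_
    · refine key.congr' ?_
      filter_upwards [hpos, hDpos, hTpd] with σ hσ hDσ hTσ
      rw [hpi σ hσ]
      congr 2
      funext w
      congr 3
      have hu : IsUnit (P σ).det := (Matrix.isUnit_iff_isUnit_det _).1 (hP σ hTσ).1.isUnit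
      have hinv : (σ • P σ)⁻¹ = σ⁻¹ • (P σ)⁻¹ := by
        have := Matrix.inv_smul' (P σ) (Units.mk0 σ hσ.ne') hu
        simpa [Units.smul_def] using this
      have hv : (fun i => (x + σ • w) i - m σ i) = σ • fun i => w i - a σ i := by
        funext i
        simp only [hma σ hσ hDσ, PiLp.add_apply, PiLp.smul_apply, smul_eq_mul, Pi.smul_apply]
        ring
      rw [hinv, hv, Matrix.mulVec_smul, Matrix.smul_mulVec, smul_smul, mul_inv_cancel₀ hσ.ne',
        one_smul]
    · refine Eventually.of_forall fun σ => f.continuous.comp ?_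
      refine (EuclideanSpace.equiv (Fin d) ℝ).symm.continuous.comp ?_
      exact Continuous.matrix_mulVec continuous_const (by fun_prop)
    · refine Eventually.of_forall fun σ w => (f.norm_coe_le_norm _).trans ?_
      nlinarith [norm_nonneg f, mul_nonneg (norm_nonneg f) (sq_nonneg ‖w‖)]
    · intro w
      have hvec : Tendsto (fun σ => (P σ)⁻¹.mulVec fun i => w i - a σ i) l
          (nhds (fun i => w i)) := by
        have h1 : Tendsto (fun σ => fun i => w i - a σ i) l (nhds (fun i => w i)) :=
          tendsto_pi_nhds.2 fun i => by simpa using (hcoord i).const_sub (w i)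
        have hc : Continuous fun p : Matrix (Fin d) (Fin d) ℝ × (Fin d → ℝ) => p.1.mulVec p.2 :=
          Continuous.matrix_mulVec continuous_fst continuous_snd
        have := (hc.tendsto (1, fun i => w i)).comp (hPinv.prodMk_nhds h1)
        simpa [Function.comp_def] using this
      have hc : Continuous fun v => f ((EuclideanSpace.equiv (Fin d) ℝ).symm v) :=
        f.continuous.comp (EuclideanSpace.equiv (Fin d) ℝ).symm.continuous
      exact (hc.tendsto (fun i => w i)).comp hvec
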